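/- For every ε ∈ (0, 1/2], one has q(ε) − 2·q(ε/2) ≥ q(1 − ε/4). -/

import Mathlib

open MeasureTheory ProbabilityTheory Set

/-- The standard Gaussian CDF. -/
noncomputable def Phi (t : ℝ) : ℝ := ((gaussianReal 0 1) (Set.Iic t)).toReal

local notation "pdf" => gaussianPDFReal 0 1

lemma gaussianPDFReal_zero_one (x : ℝ) :
    pdf x = (√(2 * Real.pi))⁻¹ * Real.exp (-(1 / 2) * x ^ 2) := by
  simp only [gaussianPDFReal_def, NNReal.coe_one, mul_one, sub_zero]
  congr 2
  ring

lemma hasDerivAt_gaussianPDFReal_zero_one (x : ℝ) : HasDerivAt pdf (-x * pdf x) x := by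
  have h : HasDerivAt (fun y : ℝ ↦ (√(2 * Real.pi))⁻¹ * Real.exp (-(1 / 2) * y ^ 2))
      (-x * pdf x) x := by
    convert! ((((hasDerivAt_id x).pow 2).const_mul (-(1 / 2) : ℝ)).exp).const_mul
      ((√(2 * Real.pi))⁻¹) using 1
    rw [gaussianPDFReal_zero_one]
    simp
    ring
  exact h.congr_of_eventuallyEq (.of_forall gaussianPDFReal_zero_one)

lemma continuous_gaussianPDFReal_zero_one : Continuous pdf :=
  continuous_iff_continuousAt.2 fun x ↦ (hasDerivAt_gaussianPDFReal_zero_one x).continuousAt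

lemma tendsto_gaussianPDFReal_zero_one_atBot :
    Filter.Tendsto pdf Filter.atBot (nhds 0) := by
  have h := (tendsto_rpow_abs_mul_exp_neg_mul_sq_cocompact (a := 1 / 2) (by norm_num) 0).mono_left
    atBot_le_cocompact
  simpa [funext gaussianPDFReal_zero_one] using h.const_mul (√(2 * Real.pi))⁻¹

lemma integrable_neg_mul_gaussianPDFReal_zero_one :
    Integrable fun x : ℝ ↦ -x * pdf x := by
  have h := (integrable_mul_exp_neg_mul_sq (b := 1 / 2) (by norm_num)).const_mul
    (-(√(2 * Real.pi))⁻¹)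
  refine h.congr (.of_forall fun x ↦ ?_)
  simp only [gaussianPDFReal_zero_one]
  ring

lemma Phi_eq_integral (t : ℝ) : Phi t = ∫ x in Iic t, pdf x := by
  rw [Phi, gaussianReal_apply_eq_integral 0 one_ne_zero, ENNReal.toReal_ofReal]
  exact integral_nonneg fun x ↦ gaussianPDFReal_nonneg 0 1 x

lemma Phi_pos (t : ℝ) : 0 < Phi t := by
  refine ENNReal.toReal_pos (fun h ↦ ?_) (measure_ne_top _ _)
  simpa using gaussianReal_absolutelyContinuous' 0 one_ne_zero h

lemma hasDerivAt_Phi (t : ℝ) : HasDerivAt Phi (pdf t) t := by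
  have hint := integrable_gaussianPDFReal 0 1
  have h := (intervalIntegral.integral_hasDerivAt_right (a := 0) (b := t)
    hint.intervalIntegrable
    (continuous_gaussianPDFReal_zero_one.stronglyMeasurableAtFilter _ _)
    continuous_gaussianPDFReal_zero_one.continuousAt).const_add (Phi 0)
  refine h.congr_of_eventuallyEq (.of_forall fun u ↦ ?_)
  simp only [Phi_eq_integral]
  rw [← intervalIntegral.integral_Iic_sub_Iic hint.integrableOn hint.integrableOn]
  ring

lemma strictMono_Phi : StrictMono Phi :=
  strictMono_of_deriv_pos fun t ↦ by
    rw [(hasDerivAt_Phi t).deriv]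
    exact gaussianPDFReal_pos 0 1 t one_ne_zero

lemma Phi_neg (t : ℝ) : Phi (-t) = 1 - Phi t := by
  have hint := integrable_gaussianPDFReal 0 1
  have hneg : ∀ x : ℝ, pdf (-x) = pdf x := fun x ↦ by simp [gaussianPDFReal_zero_one]
  have h := integral_comp_neg_Iic (-t) (gaussianPDFReal 0 1)
  have hadd := intervalIntegral.integral_Iic_add_Ioi (b := t) hint.integrableOn hint.integrableOn
  rw [integral_gaussianPDFReal_eq_one 0 one_ne_zero] at hadd
  simp only [hneg, neg_neg] at h
  rw [Phi_eq_integral, Phi_eq_integral, h]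
  linarith

lemma mul_Phi_add_gaussianPDFReal_nonneg (t : ℝ) : 0 ≤ t * Phi t + pdf t := by
  have hint := integrable_gaussianPDFReal 0 1
  have h := integral_Iic_of_hasDerivAt_of_tendsto' (a := t)
    (fun x _ ↦ hasDerivAt_gaussianPDFReal_zero_one x)
    integrable_neg_mul_gaussianPDFReal_zero_one.integrableOn
    tendsto_gaussianPDFReal_zero_one_atBot
  have key : t * Phi t + pdf t = ∫ x in Iic t, (t * pdf x + -x * pdf x) := by
    rw [integral_add (hint.const_mul t).integrableOn
      integrable_neg_mul_gaussianPDFReal_zero_one.integrableOn, h, integral_const_mul,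
      ← Phi_eq_integral, sub_zero]
  rw [key]
  refine setIntegral_nonneg measurableSet_Iic fun x hx ↦ ?_
  rw [← add_mul]
  exact mul_nonneg (by linarith [mem_Iic.1 hx]) (gaussianPDFReal_nonneg 0 1 x)

lemma concaveOn_log_Phi : ConcaveOn ℝ univ fun t ↦ Real.log (Phi t) := by
  have hd (t : ℝ) : HasDerivAt (fun t ↦ Real.log (Phi t)) (pdf t / Phi t) t :=
    (hasDerivAt_Phi t).log (Phi_pos t).ne'
  have hd2 (t : ℝ) := (hasDerivAt_gaussianPDFReal_zero_one t).div (hasDerivAt_Phi t) (Phi_pos t).ne'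
  refine Antitone.concaveOn_univ_of_deriv (fun t ↦ (hd t).differentiableAt) ?_
  rw [show deriv (fun t ↦ Real.log (Phi t)) = pdf / Phi from funext fun t ↦ (hd t).deriv]
  refine antitone_of_deriv_nonpos (fun t ↦ (hd2 t).differentiableAt) fun t ↦ ?_
  rw [(hd2 t).deriv]
  refine div_nonpos_of_nonpos_of_nonneg ?_ (sq_nonneg _)
  nlinarith [mul_nonneg (gaussianPDFReal_nonneg 0 1 t) (mul_Phi_add_gaussianPDFReal_nonneg t)]

lemma Phi_mul_Phi_le_sq (u v : ℝ) : Phi u * Phi v ≤ Phi ((u + v) / 2) ^ 2 := by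
  have h := concaveOn_log_Phi.2 (mem_univ u) (mem_univ v) (one_half_pos (α := ℝ)).le
    one_half_pos.le (add_halves 1)
  rw [smul_eq_mul, smul_eq_mul, smul_eq_mul, smul_eq_mul,
    show 1 / 2 * u + 1 / 2 * v = (u + v) / 2 by ring] at h
  have hu := Phi_pos u
  have hv := Phi_pos v
  rw [← Real.log_le_log_iff (mul_pos hu hv) (pow_pos (Phi_pos _) 2),
    Real.log_mul hu.ne' hv.ne', Real.log_pow]
  push_cast
  linarith

/-- For every `ε ∈ (0,1/2]`, `q(ε) − 2q(ε/2) ≥ q(1 − ε/4)`, where `q` is the standard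
Gaussian quantile function. -/
theorem stmt14 (q : ℝ → ℝ) (hq : ∀ p ∈ Set.Ioo (0 : ℝ) 1, Phi (q p) = p)
    (ε : ℝ) (hε0 : 0 < ε) (hε : ε ≤ 1 / 2) :
    q ε - 2 * q (ε / 2) ≥ q (1 - ε / 4) := by
  have h1 := hq ε ⟨hε0, by linarith⟩
  have h2 := hq (ε / 2) ⟨by linarith, by linarith⟩
  have h4 := Phi_neg (q (1 - ε / 4))
  rw [hq (1 - ε / 4) ⟨by linarith, by linarith⟩] at h4
  have hmid := Phi_mul_Phi_le_sq (q ε) (-q (1 - ε / 4))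
  rw [h1, h4] at hmid
  have hle : Phi (q (ε / 2)) ≤ Phi ((q ε + -q (1 - ε / 4)) / 2) := by
    rw [h2]
    exact (sq_le_sq₀ (by linarith) (Phi_pos _).le).1 (by linarith)
  have := strictMono_Phi.le_iff_le.1 hle
  linarith
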